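/- (Stein identity for the GIG distribution: sufficiency.) Let p ∈ ℝ, a, b > 0, and let X be a random variable following the GIG(p, a, b) distribution with density f_{p,a,b}. Then for every differentiable function h : (0, ∞) → ℝ such that lim_{x→∞} f_{p,a,b}(x)·h(x) = 0, lim_{x→0⁺} f_{p,a,b}(x)·h(x) = 0, and such that x ↦ h′(x) + ((p−1)/x + b/(2x²) − a/2)·h(x) is integrable with respect to the law of X, one has E[h′(X) + ((p−1)/X + b/(2X²) − a/2)·h(X)] = 0. -/

import Mathlib

open MeasureTheory ProbabilityTheory Real Set Filter

/-- Unnormalized density of the GIG(p, a, b) distribution on (0, ∞). -/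
noncomputable def gigpdf (p a b : ℝ) (x : ℝ) : ℝ :=
  if 0 < x then x ^ (p - 1) * Real.exp (-(a * x + b / x) / 2) else 0

/-- The normalized GIG(p, a, b) density `f_{p,a,b}`. -/
noncomputable def gigpdfN (p a b : ℝ) (x : ℝ) : ℝ :=
  gigpdf p a b x / ∫ t in Set.Ioi (0 : ℝ), gigpdf p a b t

theorem gigpdf_nonneg (p a b x : ℝ) : 0 ≤ gigpdf p a b x := by
  unfold gigpdf
  split_ifs with hx
  · positivity
  · exact le_rfl

theorem gigpdfN_nonneg (p a b x : ℝ) : 0 ≤ gigpdfN p a b x :=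
  div_nonneg (gigpdf_nonneg p a b x) (integral_nonneg fun t => gigpdf_nonneg p a b t)

theorem gigpdfN_of_nonpos (p a b : ℝ) {x : ℝ} (hx : x ≤ 0) : gigpdfN p a b x = 0 := by
  simp [gigpdfN, gigpdf, hx.not_gt]

theorem measurable_gigpdfN (p a b : ℝ) : Measurable (gigpdfN p a b) := by
  unfold gigpdfN gigpdf
  refine Measurable.div_const (Measurable.ite measurableSet_Ioi ?_ measurable_const) _
  fun_prop

theorem hasDerivAt_gigpdfN (p a b : ℝ) {x : ℝ} (hx : 0 < x) :
    HasDerivAt (gigpdfN p a b)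
      (gigpdfN p a b x * ((p - 1) / x + b / (2 * x ^ 2) - a / 2)) x := by
  have hexponent : HasDerivAt (fun y : ℝ => -(a * y + b / y) / 2)
      (-(a + -b / x ^ 2) / 2) x := by
    have hdiv : HasDerivAt (fun y : ℝ => b / y) (-b / x ^ 2) x := by
      exact ((hasDerivAt_const x b).div (hasDerivAt_id' x) hx.ne').congr_deriv (by simp)
    simpa using ((((hasDerivAt_id' x).const_mul a).add hdiv).neg.div_const 2)
  have hpow : HasDerivAt (fun y : ℝ => y ^ (p - 1)) ((p - 1) * x ^ (p - 1 - 1)) x :=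
    Real.hasDerivAt_rpow_const (Or.inl hx.ne')
  have hpdf : HasDerivAt (gigpdf p a b)
      (gigpdf p a b x * ((p - 1) / x + b / (2 * x ^ 2) - a / 2)) x := by
    refine ((hpow.mul hexponent.exp).congr_of_eventuallyEq ?_).congr_deriv ?_
    · filter_upwards [Ioi_mem_nhds hx] with y hy
      simp [gigpdf, mem_Ioi.mp hy]
    · rw [gigpdf, if_pos hx, Real.rpow_sub_one hx.ne' (p - 1)]
      field_simp
      ring
  exact (hpdf.div_const _).congr_deriv (by rw [gigpdfN]; ring)

theorem withDensity_gigpdfN_eq_restrict (p a b : ℝ) :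
    volume.withDensity (fun x => ENNReal.ofReal (gigpdfN p a b x)) =
      (volume.restrict (Ioi 0)).withDensity (fun x => ENNReal.ofReal (gigpdfN p a b x)) := by
  rw [← withDensity_indicator measurableSet_Ioi]
  congr 1
  ext x
  by_cases hx : 0 < x
  · simp [hx]
  · simp [gigpdfN_of_nonpos p a b (not_lt.mp hx), indicator_of_notMem (mem_Ioi.not.mpr hx)]

/-- Stein identity for the GIG distribution (sufficiency): if `X ~ GIG(p, a, b)`, then
`E[h'(X) + ((p-1)/X + b/(2X²) - a/2) h(X)] = 0` for every differentiable `h` such that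
`f_{p,a,b}·h` vanishes at `0⁺` and `∞` and the Stein operator applied to `h` is integrable
with respect to the law of `X`. -/
theorem gig_stein_identity
    {Ω : Type*} [MeasurableSpace Ω] (μ : Measure Ω) [IsProbabilityMeasure μ]
    (p a b : ℝ) (ha : 0 < a) (hb : 0 < b)
    (X : Ω → ℝ) (hXm : Measurable X)
    (hX : Measure.map X μ = volume.withDensity (fun x => ENNReal.ofReal (gigpdfN p a b x)))
    (h h' : ℝ → ℝ)
    (hderiv : ∀ x ∈ Set.Ioi (0 : ℝ), HasDerivAt h (h' x) x)
    (hlim_top : Tendsto (fun x => gigpdfN p a b x * h x) atTop (nhds 0))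
    (hlim_zero : Tendsto (fun x => gigpdfN p a b x * h x)
      (nhdsWithin 0 (Set.Ioi 0)) (nhds 0))
    (hint : Integrable
      (fun ω => h' (X ω) + ((p - 1) / X ω + b / (2 * X ω ^ 2) - a / 2) * h (X ω)) μ) :
    ∫ ω, (h' (X ω) + ((p - 1) / X ω + b / (2 * X ω ^ 2) - a / 2) * h (X ω)) ∂μ = 0 := by
  set g : ℝ → ℝ := fun x => h' x + ((p - 1) / x + b / (2 * x ^ 2) - a / 2) * h x with hg_def
  have hh' : AEStronglyMeasurable h' (volume.restrict (Ioi 0)) :=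
    (aestronglyMeasurable_deriv h _).congr <|
      (ae_restrict_iff' measurableSet_Ioi).mpr <| ae_of_all _ fun x hx => (hderiv x hx).deriv
  have hh : AEStronglyMeasurable h (volume.restrict (Ioi 0)) :=
    ContinuousOn.aestronglyMeasurable
      (fun x hx => (hderiv x hx).continuousAt.continuousWithinAt) measurableSet_Ioi
  have hcoeff : Measurable fun x : ℝ => (p - 1) / x + b / (2 * x ^ 2) - a / 2 := by fun_prop
  have hg : AEStronglyMeasurable g (volume.restrict (Ioi 0)) :=
    hh'.add (hcoeff.aestronglyMeasurable.mul hh)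
  rw [withDensity_gigpdfN_eq_restrict] at hX
  have hgX : AEStronglyMeasurable g (Measure.map X μ) := by
    rw [hX]
    exact hg.mono_ac (withDensity_absolutelyContinuous _ _)
  have hdens : Measurable fun x => ENNReal.ofReal (gigpdfN p a b x) :=
    (measurable_gigpdfN p a b).ennreal_ofReal
  have hgint : Integrable g (Measure.map X μ) :=
    (integrable_map_measure hgX hXm.aemeasurable).mpr hint
  rw [hX, integrable_withDensity_iff_integrable_smul' hdens
    (ae_of_all _ fun _ => ENNReal.ofReal_lt_top)] at hgint
  change ∫ ω, g (X ω) ∂μ = 0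
  rw [← integral_map hXm.aemeasurable hgX, hX,
    integral_withDensity_eq_integral_toReal_smul hdens
      (ae_of_all _ fun _ => ENNReal.ofReal_lt_top)]
  have hprod : (fun x => (ENNReal.ofReal (gigpdfN p a b x)).toReal • g x) = fun x =>
      gigpdfN p a b x * ((p - 1) / x + b / (2 * x ^ 2) - a / 2) * h x +
        gigpdfN p a b x * h' x := by
    ext x
    rw [ENNReal.toReal_ofReal (gigpdfN_nonneg p a b x), smul_eq_mul]
    simp only [hg_def]
    ring
  rw [hprod] at hgint ⊢
  simpa using integral_Ioi_deriv_mul_eq_sub (fun x hx => hasDerivAt_gigpdfN p a b hx) hderiv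
    hgint hlim_zero hlim_top
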